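/- arXiv:1302.2378 — 3 statements merged into one kernel-verified Lean document; each statement's English description precedes it below -/
import Mathlib

section
/- Let X be a set with decidable equality, let F = FreeGroup X, and for w ∈ F let ‖w‖ denote the word norm of w, i.e. the length of the unique reduced word representing w. Every finitely generated subgroup A of F is undistorted in F in the following sense: there exist a finite subset S of A that generates A and a natural number C ≥ 1 such that every a ∈ A can be written as a product of at most C·‖a‖ + C elements of S ∪ S⁻¹. -/
/-- A prefix of `L₁ ++ L₂` is a prefix of `L₁`, or `L₁` followed by a prefix of `L₂`. -/
theorem List.IsPrefix.of_append {α : Type*} {N L₁ L₂ : List α} (h : N <+: L₁ ++ L₂) :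
    N <+: L₁ ∨ ∃ t, N = L₁ ++ t ∧ t <+: L₂ := by
  obtain ⟨s, hs⟩ := h
  rcases List.append_eq_append_iff.mp hs with ⟨t, rfl, _⟩ | ⟨t, rfl, h⟩
  exacts [Or.inl (List.prefix_append _ _), Or.inr ⟨t, rfl, s, h.symm⟩]

namespace FreeGroup

open scoped Pointwise

/-- Every prefix of a reduction of `L` represents the same element as some prefix of `L`. -/
theorem Red.exists_prefix_mk_eq {X : Type*} {L M : List (X × Bool)} (h : Red L M)
    {N : List (X × Bool)} (hN : N <+: M) : ∃ N', N' <+: L ∧ mk N' = mk N := by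
  induction h using Relation.ReflTransGen.head_induction_on with
  | refl => exact ⟨N, hN, rfl⟩
  | head hstep _ ih =>
    obtain ⟨N', hN', hmk⟩ := ih
    rw [← hmk]
    cases hstep with
    | @not L₁ L₂ x b =>
      rcases hN'.of_append with h | ⟨t, rfl, ht⟩
      · exact ⟨N', h.trans (List.prefix_append _ _), rfl⟩
      · refine ⟨L₁ ++ (x, b) :: (x, !b) :: t, ?_, Quot.sound Red.Step.not⟩
        simpa [List.prefix_append_right_inj] using ht

/-- The letters occurring in reduced words of a finitely generated subgroup lie in a finite set. -/
theorem exists_finset_letters_of_closure {X : Type*} [DecidableEq X]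
    (T : Finset (FreeGroup X)) :
    ∃ B : Finset X, ∀ a ∈ Subgroup.closure (T : Set (FreeGroup X)),
      ∀ x ∈ a.toWord, x.1 ∈ B := by
  refine ⟨T.biUnion fun t => (t.toWord.map Prod.fst).toFinset, fun a ha => ?_⟩
  induction ha using Subgroup.closure_induction with
  | mem t ht =>
    intro x hx
    exact Finset.mem_biUnion.mpr ⟨t, ht, List.mem_toFinset.mpr (List.mem_map_of_mem hx)⟩
  | one => simp
  | mul a b _ _ iha ihb =>
    intro x hx
    rcases List.mem_append.mp ((toWord_mul_sublist a b).subset hx) with h | h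
    exacts [iha x h, ihb x h]
  | inv a _ iha =>
    intro x hx
    rw [toWord_inv] at hx
    simp only [invRev, List.mem_reverse, List.mem_map] at hx
    obtain ⟨y, hy, rfl⟩ := hx
    exact iha y hy

/-- Finitely generated subgroups of a free group are quasiconvex: the prefixes of their reduced
words lie in finitely many right cosets. -/
theorem exists_finset_prefixes_of_closure {X : Type*} [DecidableEq X]
    (T : Finset (FreeGroup X)) :
    ∃ P : Finset (FreeGroup X), 1 ∈ P ∧ ∀ a ∈ Subgroup.closure (T : Set (FreeGroup X)),
      ∀ N, N <+: a.toWord → ∃ p ∈ P, mk N * p⁻¹ ∈ Subgroup.closure (T : Set (FreeGroup X)) := by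
  refine ⟨insert 1 (T.biUnion fun t => (t.toWord.inits.map mk).toFinset),
    Finset.mem_insert_self _ _, fun a ha => ?_⟩
  induction ha using Subgroup.closure_induction with
  | mem t ht =>
    intro N hN
    refine ⟨mk N, Finset.mem_insert_of_mem (Finset.mem_biUnion.mpr ⟨t, ht, ?_⟩),
      by rw [mul_inv_cancel]; exact one_mem _⟩
    exact List.mem_toFinset.mpr (List.mem_map_of_mem ((List.mem_inits _ _).mpr hN))
  | one =>
    intro N hN
    rw [toWord_one, List.prefix_nil] at hN
    exact ⟨1, Finset.mem_insert_self _ _, by simp [hN, ← one_eq_mk]⟩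
  | mul a b ha _ iha ihb =>
    intro N hN
    rw [toWord_mul] at hN
    obtain ⟨N', hN', hmk⟩ := reduce.red.exists_prefix_mk_eq hN
    rw [← hmk]
    rcases hN'.of_append with h | ⟨t, rfl, ht⟩
    · exact iha N' h
    · obtain ⟨p, hp, hmem⟩ := ihb t ht
      refine ⟨p, hp, ?_⟩
      rw [← mul_mk, mk_toWord, mul_assoc]
      exact mul_mem ha hmem
  | inv a ha iha =>
    rintro N ⟨M, hM⟩
    have hword : a.toWord = invRev M ++ invRev N := by
      rw [← invRev_append, hM, toWord_inv, invRev_invRev]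
    obtain ⟨p, hp, hmem⟩ := iha (invRev M) ⟨invRev N, hword.symm⟩
    refine ⟨p, hp, ?_⟩
    have hN : mk N = a⁻¹ * mk (invRev M) := by
      rw [← mk_toWord (x := a⁻¹), ← hM, ← mul_mk, ← inv_mk, mul_inv_cancel_right]
    rw [hN, mul_assoc]
    exact mul_mem (inv_mem ha) hmem

/-- If the prefixes of the word `L₁ ++ L₂` stay within `P` of the subgroup `A`, then following the
suffix `L₂` expresses it as a product of elements of `A` of the form `p * e * q⁻¹`. -/
theorem exists_list_prod_eq_of_prefixes {X : Type*} {A : Subgroup (FreeGroup X)}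
    {P E : Set (FreeGroup X)} (hP : 1 ∈ P) (hE : 1 ∈ E) (L₂ : List (X × Bool)) :
    ∀ (L₁ : List (X × Bool)) (p : FreeGroup X), mk (L₁ ++ L₂) ∈ A →
      (∀ N, N <+: L₁ ++ L₂ → ∃ q ∈ P, mk N * q⁻¹ ∈ A) →
      (∀ x ∈ L₂, mk [x] ∈ E) → p ∈ P → mk L₁ * p⁻¹ ∈ A →
      ∃ l : List (FreeGroup X), (∀ g ∈ l, g ∈ A ∧ g ∈ P * E * P⁻¹) ∧
        l.length ≤ L₂.length + 1 ∧ l.prod = p * mk L₂ := by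
  induction L₂ with
  | nil =>
    intro L₁ p hA _ _ hp hpA
    rw [List.append_nil] at hA
    refine ⟨[p], ?_, by simp, by simp [← one_eq_mk]⟩
    simp only [List.mem_singleton, forall_eq]
    refine ⟨?_, ?_⟩
    · simpa [-inv_mk] using mul_mem (inv_mem hpA) hA
    · simpa using Set.mul_mem_mul (Set.mul_mem_mul hp hE) (Set.inv_mem_inv.mpr hP)
  | cons x L ih =>
    intro L₁ p hA hpre hlet hp hpA
    have happ : L₁ ++ x :: L = (L₁ ++ [x]) ++ L := by simp
    obtain ⟨q, hq, hqA⟩ := hpre (L₁ ++ [x]) (happ ▸ List.prefix_append _ _)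
    rw [happ] at hA hpre
    obtain ⟨l, hl, hlen, hprod⟩ := ih (L₁ ++ [x]) q hA hpre
      (fun y hy => hlet y (List.mem_cons_of_mem _ hy)) hq hqA
    refine ⟨(p * mk [x] * q⁻¹) :: l, ?_, by simpa using hlen, ?_⟩
    · refine List.forall_mem_cons.mpr ⟨⟨?_, ?_⟩, hl⟩
      · have h := mul_mem (inv_mem hpA) hqA
        rw [← mul_mk] at h
        simpa [-inv_mk, -mul_mk, mul_assoc] using h
      · exact Set.mul_mem_mul (Set.mul_mem_mul hp (hlet x List.mem_cons_self))
          (Set.inv_mem_inv.mpr hq)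
    · rw [List.prod_cons, hprod, mul_assoc, inv_mul_cancel_left, mul_assoc, mul_mk,
        List.singleton_append]

/-- A finitely generated subgroup of a free group has a finite subset `S` containing a given finite
generating set, such that every `a` in the subgroup is a product of at most `‖a‖ + 1` elements
of `S`. -/
theorem exists_finset_list_prod_eq_of_closure {X : Type*} [DecidableEq X]
    (T : Finset (FreeGroup X)) :
    ∃ S : Finset (FreeGroup X), T ⊆ S ∧
      (S : Set (FreeGroup X)) ⊆ Subgroup.closure (T : Set (FreeGroup X)) ∧
      ∀ a ∈ Subgroup.closure (T : Set (FreeGroup X)), ∃ l : List (FreeGroup X),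
        (∀ x ∈ l, x ∈ S) ∧ l.length ≤ norm a + 1 ∧ l.prod = a := by
  classical
  obtain ⟨B, hB⟩ := exists_finset_letters_of_closure T
  obtain ⟨P, hP1, hP⟩ := exists_finset_prefixes_of_closure T
  let E : Finset (FreeGroup X) :=
    insert 1 ((B ×ˢ (Finset.univ : Finset Bool)).image fun x => mk [x])
  refine ⟨T ∪ (P * E * P⁻¹).filter (· ∈ Subgroup.closure (T : Set (FreeGroup X))),
    Finset.subset_union_left, fun g hg => ?_, fun a ha => ?_⟩
  · rcases Finset.mem_union.mp hg with h | h
    exacts [Subgroup.subset_closure h, (Finset.mem_filter.mp h).2]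
  obtain ⟨l, hl, hlen, hprod⟩ := exists_list_prod_eq_of_prefixes
    (A := Subgroup.closure (T : Set (FreeGroup X))) (P := P) (E := E) hP1
    (Finset.mem_insert_self _ _) a.toWord [] 1 (by simpa [mk_toWord] using ha)
    (hP a ha) (fun x hx => Finset.mem_insert_of_mem (Finset.mem_image_of_mem _
      (Finset.mem_product.mpr ⟨hB a ha x hx, Finset.mem_univ _⟩))) hP1
    (by simp [← one_eq_mk])
  refine ⟨l, fun g hg => ?_, hlen, by simpa [mk_toWord] using hprod⟩
  refine Finset.mem_union_right _ (Finset.mem_filter.mpr ⟨?_, (hl g hg).1⟩)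
  exact_mod_cast (hl g hg).2

end FreeGroup

/-- Every finitely generated subgroup `A` of a free group is undistorted: there are a
finite generating set `S` of `A` and a constant `C ≥ 1` such that every `a ∈ A` can be
written as a product of at most `C * ‖a‖ + C` elements of `S ∪ S⁻¹`, where `‖·‖` is the
word norm of the free group. (Fact 1.1(2)) -/
theorem finiteRank_subgroup_undistorted
    {X : Type*} [DecidableEq X] (A : Subgroup (FreeGroup X)) (hfg : A.FG) :
    ∃ (S : Finset (FreeGroup X)) (C : ℕ), 1 ≤ C ∧
      (S : Set (FreeGroup X)) ⊆ (A : Set (FreeGroup X)) ∧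
      Subgroup.closure (S : Set (FreeGroup X)) = A ∧
      ∀ a ∈ A, ∃ l : List (FreeGroup X),
        (∀ x ∈ l, x ∈ (S : Set (FreeGroup X)) ∪ (S : Set (FreeGroup X))⁻¹) ∧
        l.length ≤ C * FreeGroup.norm a + C ∧
        l.prod = a := by
  obtain ⟨T, rfl⟩ := hfg
  obtain ⟨S, hTS, hS, hprod⟩ := FreeGroup.exists_finset_list_prod_eq_of_closure T
  refine ⟨S, 1, le_rfl, hS, le_antisymm ((Subgroup.closure_le _).mpr hS)
    (Subgroup.closure_mono (Finset.coe_subset.mpr hTS)), fun a ha => ?_⟩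
  obtain ⟨l, hl, hlen, rfl⟩ := hprod a ha
  exact ⟨l, fun x hx => Or.inl (hl x hx), by rwa [one_mul], rfl⟩
end

section
/- Let X be a set, let F = FreeGroup X, let S ⊆ X, and let A be the subgroup of F generated by {FreeGroup.of s : s ∈ S} (a free factor of F). Then A is malnormal in F: for every g ∈ F with g ∉ A, the intersection gAg⁻¹ ∩ A is the trivial subgroup {1}. -/
namespace FreeGroup

variable {X : Type*} {S : Set X}

theorem mk_mem_closure_of_image {L : List (X × Bool)} (hL : ∀ p ∈ L, p.1 ∈ S) :
    mk L ∈ Subgroup.closure (of '' S) := by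
  induction L with
  | nil => exact one_mem _
  | cons p L ih =>
    have hp : of p.1 ∈ Subgroup.closure (of '' S) :=
      Subgroup.subset_closure ⟨_, hL p (by simp), rfl⟩
    have hsplit : mk (p :: L) = mk [p] * mk L := by rw [mul_mk]; rfl
    rw [hsplit]
    refine mul_mem ?_ (ih fun q hq => hL q (List.mem_cons_of_mem _ hq))
    obtain ⟨x, _ | _⟩ := p
    · exact inv_mem hp
    · exact hp

theorem fst_mem_of_mem_toWord [DecidableEq X] {a : FreeGroup X}
    (ha : a ∈ Subgroup.closure (of '' S)) : ∀ p ∈ a.toWord, p.1 ∈ S := by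
  induction ha using Subgroup.closure_induction with
  | mem x hx => obtain ⟨s, hs, rfl⟩ := hx; simpa using hs
  | one => simp
  | mul x y _ _ hx hy =>
    intro p hp
    rcases List.mem_append.1 ((toWord_mul_sublist x y).subset hp) with h | h
    exacts [hx p h, hy p h]
  | inv x _ hx =>
    intro p hp
    rw [toWord_inv] at hp
    simp only [invRev, List.mem_reverse, List.mem_map] at hp
    obtain ⟨q, hq, rfl⟩ := hp
    exact hx q hq

/-- Conjugating a nontrivial reduced word over `S` by a reduced word whose last letter lies
outside `S` involves no cancellation. -/
theorem isReduced_conj_of_notMem [DecidableEq X] {L W : List (X × Bool)} {x : X × Bool}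
    (hL : IsReduced (L ++ [x])) (hx : x.1 ∉ S) (hW : IsReduced W) (hne : W ≠ [])
    (hWS : ∀ p ∈ W, p.1 ∈ S) : IsReduced (L ++ [x] ++ W ++ invRev (L ++ [x])) := by
  have hinv : IsReduced (invRev (L ++ [x])) := by
    rw [isReduced_iff_reduce_eq, reduce_invRev, hL.reduce_eq]
  have hhead : (invRev (L ++ [x])).head? = some (x.1, !x.2) := by simp [invRev]
  unfold IsReduced at *
  rw [List.isChain_append, List.isChain_append]
  refine ⟨⟨hL, hW, ?_⟩, hinv, ?_⟩
  · intro p hp q hq hpq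
    obtain rfl : x = p := by simpa using hp
    exact absurd (hpq ▸ hWS q (List.mem_of_mem_head? hq)) hx
  · intro p hp q hq hpq
    rw [hhead] at hq
    rw [List.getLast?_append_of_ne_nil _ hne] at hp
    obtain rfl : (x.1, !x.2) = q := by simpa using hq
    exact absurd (hpq ▸ hWS p (List.mem_of_mem_getLast? hp)) hx

theorem mk_mem_closure_of_conj_mem {L : List (X × Bool)} (hL : IsReduced L) {a : FreeGroup X}
    (ha : a ∈ Subgroup.closure (of '' S)) (hne : a ≠ 1)
    (hconj : mk L * a * (mk L)⁻¹ ∈ Subgroup.closure (of '' S)) :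
    mk L ∈ Subgroup.closure (of '' S) := by
  classical
  induction L using List.reverseRecOn generalizing a with
  | nil => exact one_mem _
  | append_singleton L x ih =>
    by_cases hx : x.1 ∈ S
    · have hxA : mk [x] ∈ Subgroup.closure (of '' S) :=
        mk_mem_closure_of_image (by simpa using hx)
      rw [← mul_mk] at hconj ⊢
      refine mul_mem (ih (List.IsChain.left_of_append hL)
        (mul_mem (mul_mem hxA ha) (inv_mem hxA)) ?_ ?_) hxA
      · rwa [Ne, conj_eq_one_iff]
      · simpa only [mul_assoc, mul_inv_rev] using hconj
    · have hred := isReduced_conj_of_notMem hL hx isReduced_toWord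
        (mt toWord_eq_nil_iff.1 hne) (fst_mem_of_mem_toWord ha)
      have hword : (mk (L ++ [x]) * a * (mk (L ++ [x]))⁻¹).toWord
          = L ++ [x] ++ a.toWord ++ invRev (L ++ [x]) := by
        rw [← hred.reduce_eq, ← toWord_mk, ← mul_mk (L₂ := invRev _),
          ← mul_mk (L₂ := a.toWord), mk_toWord, inv_mk]
      exact absurd (fst_mem_of_mem_toWord hconj x (by rw [hword]; simp)) hx

end FreeGroup

/-- Every free factor of a free group is malnormal: if `A` is the subgroup of
`FreeGroup X` generated by the canonical generators indexed by a subset `S ⊆ X`,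
then for every `g ∉ A` we have `gAg⁻¹ ∩ A = {1}`. -/
theorem freeFactor_malnormal
    {X : Type*} (S : Set X) (A : Subgroup (FreeGroup X))
    (hA : A = Subgroup.closure (FreeGroup.of '' S)) :
    ∀ g : FreeGroup X, g ∉ A →
      (Subgroup.map (MulAut.conj g).toMonoidHom A) ⊓ A = ⊥ := by
  classical
  subst hA
  intro g hg
  rw [eq_bot_iff]
  rintro _ ⟨⟨a, ha, rfl⟩, hconj⟩
  by_cases hne : a = 1
  · simp [hne]
  · refine absurd ?_ hg
    rw [← FreeGroup.mk_toWord (x := g)]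
    refine FreeGroup.mk_mem_closure_of_conj_mem FreeGroup.isReduced_toWord ha hne ?_
    simpa [FreeGroup.mk_toWord] using hconj
end

section
/- Let X be a set, let F = FreeGroup X, and let S, T ⊆ X be disjoint subsets. Let A be the subgroup of F generated by {FreeGroup.of s : s ∈ S} and B the subgroup generated by {FreeGroup.of t : t ∈ T}. Then for every g ∈ F, the intersection gAg⁻¹ ∩ B is the trivial subgroup {1}. -/
/-- Distinct free factors in a common free factorization are mutually malnormal:
if `A` and `B` are the subgroups of `FreeGroup X` generated by the canonical
generators indexed by disjoint subsets `S, T ⊆ X`, then every conjugate of `A`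
meets `B` trivially. -/
theorem freeFactorSystem_mutually_malnormal
    {X : Type*} (S T : Set X) (hST : Disjoint S T)
    (A B : Subgroup (FreeGroup X))
    (hA : A = Subgroup.closure (FreeGroup.of '' S))
    (hB : B = Subgroup.closure (FreeGroup.of '' T)) :
    ∀ g : FreeGroup X,
      (Subgroup.map (MulAut.conj g).toMonoidHom A) ⊓ B = ⊥ := by
  classical
  intro g
  subst hA hB
  let φ : FreeGroup X →* FreeGroup X :=
    FreeGroup.lift fun x => if x ∈ S then 1 else FreeGroup.of x
  have hker : Subgroup.closure (FreeGroup.of '' S) ≤ φ.ker := by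
    rw [Subgroup.closure_le]
    rintro _ ⟨s, hs, rfl⟩
    simp [φ, MonoidHom.mem_ker, hs]
  have hfix : Set.EqOn φ (MonoidHom.id _) (Subgroup.closure (FreeGroup.of '' T)) := by
    apply MonoidHom.eqOn_closure
    rintro _ ⟨t, ht, rfl⟩
    simp [φ, hST.notMem_of_mem_right ht]
  rw [eq_bot_iff]
  rintro _ ⟨⟨a, ha, rfl⟩, hb⟩
  have hφ := hfix hb
  have ha' : φ a = 1 := hker ha
  simpa [ha', eq_comm] using hφ
end
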